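/- Let π : E → M be a real-analytic vector bundle with real-analytic connection ∇, and let x ∈ M, e ∈ E_x. If (∇^k R)(v₁,…,v_{k+2})e = 0 for all v₁,…,v_{k+2} ∈ T_xM and all k ≥ 0, where R is the curvature tensor of ∇, then there exists a ∇-parallel local section s of E defined on an open neighborhood of x with s(x) = e. -/

import Mathlib

/-!
STATEMENT 12 (existence of a local parallel section, real-analytic case).

Chart picture: the real-analytic vector bundle `π : E → M` is trivialized as `E = M × V`,
with the real-analytic connection `∇` given by its Christoffel symbol
`Γ : M → M →L[ℝ] V →L[ℝ] V` (`∇_v s = ds(v) + Γ x v (s x)`).  The curvature tensor, as a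
`Lin(V)`-valued `2`-form, is
`R(v,w) x = (∂_v Γ)(w) - (∂_w Γ)(v) + Γ v ∘ Γ w - Γ w ∘ Γ v : V →L[ℝ] V`,
and the covariant derivative of a `Lin(V)`-valued section `L` in the (constant) direction
`z` is `(∇_z L) x = (∂_z L) x + Γ x z ∘ L x - L x ∘ Γ x z`.  The hypothesis
`(∇^k R)(v₁, …, v_{k+2}) e = 0` for all arguments and all `k ≥ 0` is expressed by the
vanishing at `x₀`, applied to `e`, of all iterated covariant derivatives
`∇_{z₁} ⋯ ∇_{z_k} (R(v,w))` (for all finite lists of directions `z_i` and all `v, w`),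
which is equivalent to it.

Conclusion: there is a `∇`-parallel local section `s` of `E` near `x₀` with `s x₀ = e`.
-/

/-- Covariant derivative of a `Lin(V)`-valued section in the constant direction `z`. -/
noncomputable def covDerEnd {M V : Type*} [NormedAddCommGroup M] [NormedSpace ℝ M]
    [NormedAddCommGroup V] [NormedSpace ℝ V]
    (Γ : M → M →L[ℝ] V →L[ℝ] V) (z : M) (L : M → V →L[ℝ] V) : M → V →L[ℝ] V :=
  fun x => fderiv ℝ L x z + (Γ x z).comp (L x) - (L x).comp (Γ x z)

/-- The curvature `R(v,w)` of the connection with Christoffel symbol `Γ`, as a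
`Lin(V)`-valued section. -/
noncomputable def curvEnd {M V : Type*} [NormedAddCommGroup M] [NormedSpace ℝ M]
    [NormedAddCommGroup V] [NormedSpace ℝ V]
    (Γ : M → M →L[ℝ] V →L[ℝ] V) (v w : M) : M → V →L[ℝ] V :=
  fun x => (fderiv ℝ Γ x v) w - (fderiv ℝ Γ x w) v
    + (Γ x v).comp (Γ x w) - (Γ x w).comp (Γ x v)

/-- Coefficients of the power series solution of `P' = -A P`, `P 0 = 1`. -/
noncomputable def odeCoef {𝔸 : Type*} [NormedRing 𝔸] [NormedAlgebra ℝ 𝔸] (b : ℕ → 𝔸) : ℕ → 𝔸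
  | 0 => 1
  | n + 1 => -((1 / ((n : ℝ) + 1)) • ∑ i : Fin (n + 1), b (n - i) * odeCoef b i)

theorem odeCoef_bound {𝔸 : Type*} [NormedRing 𝔸] [NormedAlgebra ℝ 𝔸] (b : ℕ → 𝔸)
    (hb : ∀ k, ‖b k‖ ≤ (1 / 4 : ℝ) ^ (k + 1)) (n : ℕ) :
    ‖odeCoef b n‖ ≤ ‖(1 : 𝔸)‖ * (1 / 4 : ℝ) ^ n := by
  induction n using Nat.strong_induction_on with
  | _ n ih =>
    rcases n with _ | n
    · simp [odeCoef]
    · rw [odeCoef, norm_neg, norm_smul]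
      have h1 : ‖∑ i : Fin (n + 1), b (n - i) * odeCoef b i‖ ≤
          ∑ i : Fin (n + 1), ‖(1 : 𝔸)‖ * (1 / 4 : ℝ) ^ (n + 1) := by
        refine norm_sum_le_of_le _ fun i _ => ?_
        refine (norm_mul_le _ _).trans ?_
        have h2 := hb (n - i)
        have h3 := ih i i.2
        calc ‖b (n - i)‖ * ‖odeCoef b i‖
            ≤ (1 / 4 : ℝ) ^ (n - i + 1) * (‖(1 : 𝔸)‖ * (1 / 4 : ℝ) ^ (i : ℕ)) := by gcongr
          _ = ‖(1 : 𝔸)‖ * ((1 / 4 : ℝ) ^ (n - i + 1) * (1 / 4 : ℝ) ^ (i : ℕ)) := by ring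
          _ = _ := by
            rw [← pow_add]; congr 2; have := i.2; omega
      have hpos : (0 : ℝ) < (n : ℝ) + 1 := by positivity
      rw [Real.norm_of_nonneg (by positivity)]
      calc _ ≤ 1 / ((n : ℝ) + 1) * (∑ i : Fin (n + 1), ‖(1 : 𝔸)‖ * (1 / 4 : ℝ) ^ (n + 1)) := by
            gcongr
        _ = _ := by
          rw [Finset.sum_const, Finset.card_univ, Fintype.card_fin, nsmul_eq_mul]
          push_cast
          field_simp

theorem odeCoef_rec {𝔸 : Type*} [NormedRing 𝔸] [NormedAlgebra ℝ 𝔸] (b : ℕ → 𝔸) (n : ℕ) :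
    ((n : ℝ) + 1) • odeCoef b (n + 1) =
      -∑ kl ∈ Finset.HasAntidiagonal.antidiagonal n, b kl.1 * odeCoef b kl.2 := by
  have hpos : ((n : ℝ) + 1) ≠ 0 := by positivity
  rw [odeCoef, smul_neg, smul_smul, mul_one_div_cancel hpos, one_smul]
  congr 1
  rw [Finset.Nat.sum_antidiagonal_eq_sum_range_succ_mk,
    ← Finset.sum_range_reflect, Finset.sum_range]
  refine Finset.sum_congr rfl fun i _ => ?_
  have h1 : n + 1 - 1 - (i : ℕ) = n - i := by omega
  have h2 : n - (n - (i : ℕ)) = i := by have := i.2; omega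
  simp only [h1, h2]

theorem exists_analytic_ode_solution {𝔸 : Type*} [NormedRing 𝔸] [NormedAlgebra ℝ 𝔸]
    [CompleteSpace 𝔸] (A : ℝ → 𝔸) (b : ℕ → 𝔸) (hb : ∀ k, ‖b k‖ ≤ (1 / 4 : ℝ) ^ (k + 1))
    (hA : ∀ t ∈ Metric.ball (0 : ℝ) 2, HasSum (fun k => t ^ k • b k) (A t)) :
    ∃ P : ℝ → 𝔸, P 0 = 1 ∧ AnalyticOnNhd ℝ P (Metric.ball 0 2) ∧
      ∀ t ∈ Metric.ball (0 : ℝ) 2, HasDerivAt P (-(A t * P t)) t := by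
  set a := odeCoef b with ha
  have hab := odeCoef_bound b hb
  let p : FormalMultilinearSeries ℝ ℝ 𝔸 := fun n => ContinuousMultilinearMap.mkPiRing ℝ (Fin n) (a n)
  have hsum : p.sum = fun t => ∑' n, t ^ n • a n := by
    ext t
    simp [FormalMultilinearSeries.sum, p]
  have hrad : ((2 : NNReal) : ENNReal) ≤ p.radius := by
    refine p.le_radius_of_bound ‖(1 : 𝔸)‖ fun n => ?_
    simp only [p, ContinuousMultilinearMap.norm_mkPiRing]
    calc ‖a n‖ * ((2 : NNReal) : ℝ) ^ n ≤ ‖(1 : 𝔸)‖ * (1 / 4 : ℝ) ^ n * 2 ^ n := by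
          gcongr
          · exact hab n
          · simp
      _ = ‖(1 : 𝔸)‖ * (1 / 2 : ℝ) ^ n := by rw [mul_assoc, ← mul_pow]; norm_num
      _ ≤ ‖(1 : 𝔸)‖ * 1 := by
          gcongr
          exact pow_le_one₀ (by norm_num) (by norm_num)
      _ = _ := mul_one _
  have hnorm : ∀ t ∈ Metric.ball (0 : ℝ) 2, ∀ n, ‖t ^ n • a n‖ ≤ ‖(1 : 𝔸)‖ * (1 / 2 : ℝ) ^ n := by
    intro t ht n
    rw [mem_ball_zero_iff] at ht
    rw [norm_smul, norm_pow]
    calc ‖t‖ ^ n * ‖a n‖ ≤ 2 ^ n * (‖(1 : 𝔸)‖ * (1 / 4 : ℝ) ^ n) := by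
          gcongr
          exact hab n
      _ = ‖(1 : 𝔸)‖ * (2 * (1 / 4)) ^ n := by rw [mul_pow]; ring
      _ = _ := by norm_num
  have hgeo : Summable fun n : ℕ => ‖(1 : 𝔸)‖ * (1 / 2 : ℝ) ^ n :=
    (summable_geometric_of_lt_one (by norm_num) (by norm_num)).mul_left _
  refine ⟨p.sum, ?_, ?_, ?_⟩
  · rw [hsum]
    simp only
    rw [tsum_eq_single 0]
    · simp [ha, odeCoef]
    · intro n hn
      simp [hn]
  · have h := (p.hasFPowerSeriesOnBall (lt_of_lt_of_le (by norm_num) hrad)).mono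
      (by norm_num) hrad
    have h2 := h.analyticOnNhd
    refine h2.mono ?_
    intro t ht
    rw [mem_ball_zero_iff] at ht
    simp only [Metric.mem_eball, edist_zero_right]
    rw [← ofReal_norm, ENNReal.ofReal_lt_coe_iff (norm_nonneg _)]
    exact_mod_cast ht
  · intro t ht
    rw [hsum]
    have hder : HasDerivAt (fun t : ℝ => ∑' n, t ^ n • a n)
        (∑' n : ℕ, ((n : ℝ) * t ^ (n - 1)) • a n) t := by
      refine hasDerivAt_tsum_of_isPreconnected
        (u := fun n : ℕ => ‖(1 : 𝔸)‖ * ((n : ℝ) ^ 1 * (1 / 2 : ℝ) ^ n))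
        (t := Metric.ball (0 : ℝ) 2) (y₀ := t)
        (g := fun n t => t ^ n • a n) (g' := fun n t => ((n : ℝ) * t ^ (n - 1)) • a n)
        ?_ Metric.isOpen_ball (convex_ball _ _).isPreconnected ?_ ?_ ht ?_ ht
      · refine Summable.mul_left _ ?_
        exact summable_pow_mul_geometric_of_norm_lt_one 1 (by norm_num)
      · intro n y _
        exact (hasDerivAt_pow n y).smul_const (a n)
      · intro n y hy
        rw [mem_ball_zero_iff] at hy
        rcases n with _ | n
        · simp
        · rw [norm_smul, norm_mul, norm_pow, Real.norm_natCast]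
          simp only [Nat.add_sub_cancel]
          calc ((n + 1 : ℕ) : ℝ) * ‖y‖ ^ n * ‖a (n + 1)‖
              ≤ ((n + 1 : ℕ) : ℝ) * 2 ^ n * (‖(1 : 𝔸)‖ * (1 / 4 : ℝ) ^ (n + 1)) := by
                gcongr
                exact hab _
            _ = ‖(1 : 𝔸)‖ * (((n + 1 : ℕ) : ℝ) ^ 1 * ((2 * (1 / 4 : ℝ)) ^ n * (1 / 4))) := by
                rw [mul_pow, pow_succ (1 / 4 : ℝ)]; ring
            _ ≤ ‖(1 : 𝔸)‖ * (((n + 1 : ℕ) : ℝ) ^ 1 * ((1 / 2 : ℝ) ^ n * (1 / 2))) := by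
                gcongr <;> norm_num
            _ = _ := by rw [pow_succ (1 / 2 : ℝ)]
      · exact Summable.of_norm_bounded hgeo (hnorm t ht)
    convert hder using 1
    have hbn : Summable fun n => ‖t ^ n • b n‖ := by
      refine Summable.of_norm_bounded (g := fun n : ℕ => (1 / 2 : ℝ) ^ n)
        (summable_geometric_of_lt_one (by norm_num) (by norm_num)) fun n => ?_
      rw [mem_ball_zero_iff] at ht
      rw [norm_norm, norm_smul, norm_pow]
      calc ‖t‖ ^ n * ‖b n‖ ≤ 2 ^ n * (1 / 4 : ℝ) ^ (n + 1) := by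
            gcongr
            exact hb n
        _ = (2 * (1 / 4)) ^ n * (1 / 4) := by rw [mul_pow, pow_succ (1 / 4 : ℝ)]; ring
        _ ≤ (1 / 2 : ℝ) ^ n * 1 := by gcongr <;> norm_num
        _ = _ := mul_one _
    have han : Summable fun n => ‖t ^ n • a n‖ :=
      Summable.of_norm_bounded hgeo fun n => by rw [norm_norm]; exact hnorm t ht n
    have hser : Summable fun n : ℕ => ((n : ℝ) * t ^ (n - 1)) • a n := by
      refine Summable.of_norm_bounded
        (g := fun n : ℕ => ‖(1 : 𝔸)‖ * ((n : ℝ) ^ 1 * (1 / 2 : ℝ) ^ n))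
        (Summable.mul_left _ (summable_pow_mul_geometric_of_norm_lt_one 1 (by norm_num))) ?_
      intro n
      rw [mem_ball_zero_iff] at ht
      rcases n with _ | n
      · simp
      · rw [norm_smul, norm_mul, norm_pow, Real.norm_natCast]
        simp only [Nat.add_sub_cancel]
        calc ((n + 1 : ℕ) : ℝ) * ‖t‖ ^ n * ‖a (n + 1)‖
            ≤ ((n + 1 : ℕ) : ℝ) * 2 ^ n * (‖(1 : 𝔸)‖ * (1 / 4 : ℝ) ^ (n + 1)) := by
              gcongr
              exact hab _
          _ = ‖(1 : 𝔸)‖ * (((n + 1 : ℕ) : ℝ) ^ 1 * ((2 * (1 / 4 : ℝ)) ^ n * (1 / 4))) := by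
              rw [mul_pow, pow_succ (1 / 4 : ℝ)]; ring
          _ ≤ ‖(1 : 𝔸)‖ * (((n + 1 : ℕ) : ℝ) ^ 1 * ((1 / 2 : ℝ) ^ n * (1 / 2))) := by
              gcongr <;> norm_num
          _ = _ := by rw [pow_succ (1 / 2 : ℝ)]
    rw [hser.tsum_eq_zero_add, ← (hA t ht).tsum_eq,
      tsum_mul_tsum_eq_tsum_sum_antidiagonal_of_summable_norm hbn han, ← tsum_neg]
    simp only [Nat.cast_zero, zero_mul, zero_smul, zero_add, Nat.add_sub_cancel]
    congr 1
    ext n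
    have hr := odeCoef_rec b n
    push_cast
    rw [mul_comm, mul_smul, ha, hr, smul_neg, Finset.smul_sum]
    congr 1
    refine Finset.sum_congr rfl fun kl hkl => ?_
    rw [Finset.HasAntidiagonal.mem_antidiagonal] at hkl
    rw [smul_mul_smul_comm, ← pow_add, hkl]

theorem analyticAt_clm_apply' {E F G : Type*} [NormedAddCommGroup E] [NormedSpace ℝ E]
    [NormedAddCommGroup F] [NormedSpace ℝ F] [NormedAddCommGroup G] [NormedSpace ℝ G]
    {f : E → F →L[ℝ] G} {g : E → F} {x : E} (hf : AnalyticAt ℝ f x) (hg : AnalyticAt ℝ g x) :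
    AnalyticAt ℝ (fun t => f t (g t)) x :=
  ((ContinuousLinearMap.id ℝ (F →L[ℝ] G)).analyticAt_bilinear (f x, g x)).comp₂ hf hg

theorem analyticAt_clm_comp' {E F G H : Type*} [NormedAddCommGroup E] [NormedSpace ℝ E]
    [NormedAddCommGroup F] [NormedSpace ℝ F] [NormedAddCommGroup G] [NormedSpace ℝ G]
    [NormedAddCommGroup H] [NormedSpace ℝ H]
    {f : E → G →L[ℝ] H} {g : E → F →L[ℝ] G} {x : E} (hf : AnalyticAt ℝ f x)
    (hg : AnalyticAt ℝ g x) :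
    AnalyticAt ℝ (fun t => (f t).comp (g t)) x :=
  ((ContinuousLinearMap.compL ℝ F G H).analyticAt_bilinear (f x, g x)).comp₂ hf hg

theorem analytic_family_eventually_zero {V : Type*} [NormedAddCommGroup V] [NormedSpace ℝ V]
    [CompleteSpace V]
    (A : ℝ → V →L[ℝ] V) (g : ℕ → ℝ → V) (hA : AnalyticAt ℝ A 0) (hg : ∀ k, AnalyticAt ℝ (g k) 0)
    (h0 : ∀ k, g k 0 = 0)
    (hd : ∀ k, ∀ᶠ t in nhds (0 : ℝ), deriv (g k) t = -(A t (g k t)) + g (k + 1) t) (k : ℕ) :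
    ∀ᶠ t in nhds (0 : ℝ), g k t = 0 := by
  have key : ∀ n : ℕ, ∀ k, (n : ℕ∞) ≤ analyticOrderAt (g k) 0 := by
    intro n
    induction n with
    | zero => intro k; simp
    | succ n ih =>
      intro k
      have h1 := (hg k).analyticOrderAt_deriv_add_one
      simp only [h0, sub_zero] at h1
      have h2 : (n : ℕ∞) ≤ analyticOrderAt (deriv (g k)) 0 := by
        obtain ⟨u, hu, hu'⟩ := (natCast_le_analyticOrderAt (hg k)).1 (ih k)
        obtain ⟨v, hv, hv'⟩ := (natCast_le_analyticOrderAt (hg (k + 1))).1 (ih (k + 1))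
        refine (natCast_le_analyticOrderAt (hg k).deriv).2
          ⟨fun t => -(A t (u t)) + v t, ((analyticAt_clm_apply' hA hu).neg).add hv, ?_⟩
        filter_upwards [hu', hv', hd k] with t h3 h4 h5
        rw [h5, h3, h4]
        simp [smul_add]
      rw [show (fun x => g k x) = g k from rfl] at h1
      rw [← h1]
      push_cast
      gcongr
  rw [← analyticOrderAt_eq_top]
  exact ENat.eq_top_iff_forall_ge.2 fun n => key n k

theorem analytic_covDerEnd {M V : Type*} [NormedAddCommGroup M] [NormedSpace ℝ M]
    [NormedAddCommGroup V] [NormedSpace ℝ V] [CompleteSpace V]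
    (Γ : M → M →L[ℝ] V →L[ℝ] V) (hΓ : ∀ x, AnalyticAt ℝ Γ x) (z : M) (L : M → V →L[ℝ] V)
    (hL : ∀ x, AnalyticAt ℝ L x) (x : M) : AnalyticAt ℝ (covDerEnd Γ z L) x := by
  have hz := analyticAt_clm_apply' (hΓ x) (analyticAt_const (v := z))
  exact ((analyticAt_clm_apply' (hL x).fderiv analyticAt_const).add
    (analyticAt_clm_comp' hz (hL x))).sub (analyticAt_clm_comp' (hL x) hz)

theorem analytic_curvEnd {M V : Type*} [NormedAddCommGroup M] [NormedSpace ℝ M]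
    [NormedAddCommGroup V] [NormedSpace ℝ V] [CompleteSpace V]
    (Γ : M → M →L[ℝ] V →L[ℝ] V) (hΓ : ∀ x, AnalyticAt ℝ Γ x) (v w : M) (x : M) :
    AnalyticAt ℝ (curvEnd Γ v w) x := by
  have hv := analyticAt_clm_apply' (hΓ x) (analyticAt_const (v := v))
  have hw := analyticAt_clm_apply' (hΓ x) (analyticAt_const (v := w))
  have dv := analyticAt_clm_apply' (analyticAt_clm_apply' (hΓ x).fderiv
    (analyticAt_const (v := v))) (analyticAt_const (v := w))
  have dw := analyticAt_clm_apply' (analyticAt_clm_apply' (hΓ x).fderiv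
    (analyticAt_const (v := w))) (analyticAt_const (v := v))
  exact ((dv.sub dw).add (analyticAt_clm_comp' hv hw)).sub (analyticAt_clm_comp' hw hv)

theorem analytic_ray {M : Type*} [NormedAddCommGroup M] [NormedSpace ℝ M] (x₀ y : M) (t : ℝ) :
    AnalyticAt ℝ (fun t : ℝ => x₀ + t • y) t := by
  exact analyticAt_const.add (analyticAt_id.smul analyticAt_const)

theorem hasDerivAt_ray {M : Type*} [NormedAddCommGroup M] [NormedSpace ℝ M] (x₀ y : M) (t : ℝ) :
    HasDerivAt (fun t : ℝ => x₀ + t • y) y t := by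
  simpa using ((hasDerivAt_id t).smul_const y).const_add x₀

theorem curvature_kills_along_ray {M V : Type*} [NormedAddCommGroup M] [NormedSpace ℝ M]
    [NormedAddCommGroup V] [NormedSpace ℝ V] [CompleteSpace V]
    (Γ : M → M →L[ℝ] V →L[ℝ] V) (hΓ : ∀ x, AnalyticAt ℝ Γ x) (x₀ : M) (e : V)
    (hflat : ∀ (l : List M) (v w : M),
      (l.foldr (covDerEnd Γ) (curvEnd Γ v w)) x₀ e = 0)
    (y : M) (σ : ℝ → V) (hσ : AnalyticOnNhd ℝ σ (Metric.ball 0 2)) (hσ0 : σ 0 = e)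
    (hσ' : ∀ t ∈ Metric.ball (0 : ℝ) 2, HasDerivAt σ (-(Γ (x₀ + t • y) y (σ t))) t)
    (w : M) (t : ℝ) (ht : t ∈ Metric.ball (0 : ℝ) 2) :
    curvEnd Γ y w (x₀ + t • y) (σ t) = 0 := by
  let G : ℕ → M → V →L[ℝ] V := fun k => (List.replicate k y).foldr (covDerEnd Γ) (curvEnd Γ y w)
  have hGs : ∀ k, G (k + 1) = covDerEnd Γ y (G k) := fun k => by
    simp [G, List.replicate_succ]
  have hG : ∀ k x, AnalyticAt ℝ (G k) x := by
    intro k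
    induction k with
    | zero => exact fun x => analytic_curvEnd Γ hΓ y w x
    | succ k ih => rw [hGs]; exact fun x => analytic_covDerEnd Γ hΓ y _ ih x
  let g : ℕ → ℝ → V := fun k t => G k (x₀ + t • y) (σ t)
  have hGray : ∀ k t, AnalyticAt ℝ (fun t : ℝ => G k (x₀ + t • y)) t := fun k t =>
    AnalyticAt.comp (g := G k) (f := fun t : ℝ => x₀ + t • y) (hG k _) (analytic_ray x₀ y t)
  have hg : ∀ k, ∀ t ∈ Metric.ball (0 : ℝ) 2, AnalyticAt ℝ (g k) t := fun k t ht =>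
    analyticAt_clm_apply' (hGray k t) (hσ t ht)
  have h0mem : (0 : ℝ) ∈ Metric.ball (0 : ℝ) 2 := Metric.mem_ball_self (by norm_num)
  have hA : AnalyticAt ℝ (fun t : ℝ => Γ (x₀ + t • y) y) 0 :=
    analyticAt_clm_apply' (AnalyticAt.comp (g := Γ) (f := fun t : ℝ => x₀ + t • y) (hΓ _)
      (analytic_ray x₀ y 0)) analyticAt_const
  have hev := analytic_family_eventually_zero (fun t : ℝ => Γ (x₀ + t • y) y) g hA
    (fun k => hg k 0 h0mem) (fun k => by simpa [g, hσ0] using hflat _ y w) (fun k => by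
      filter_upwards [Metric.isOpen_ball.mem_nhds h0mem] with t ht
      have h1 : HasDerivAt (fun t : ℝ => G k (x₀ + t • y)) (fderiv ℝ (G k) (x₀ + t • y) y) t :=
        (hG k (x₀ + t • y)).differentiableAt.hasFDerivAt.comp_hasDerivAt t (hasDerivAt_ray x₀ y t)
      have h2 := (h1.clm_apply (hσ' t ht)).deriv
      change deriv (fun t => G k (x₀ + t • y) (σ t)) t = _
      rw [h2]
      simp only [g, hGs, covDerEnd]
      simp
      abel) 0
  exact (AnalyticOnNhd.eqOn_zero_of_preconnected_of_eventuallyEq_zero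
    (fun t ht => hg 0 t ht) (convex_ball _ _).isPreconnected h0mem hev) ht

theorem uniform_taylor {M W : Type*} [NormedAddCommGroup M] [NormedSpace ℝ M]
    [NormedAddCommGroup W] [NormedSpace ℝ W] (F : M → ℝ → W) (F' : M → ℝ → M →L[ℝ] W) (y : M)
    (hF : ∀ z t, HasFDerivAt (fun z => F z t) (F' z t) z)
    (hc : Continuous fun q : M × ℝ => F' q.1 q.2) (ε : ℝ) (hε : 0 < ε) :
    ∀ᶠ z in nhds y, ∀ t ∈ Set.Icc (0 : ℝ) 1, ‖F z t - F y t - F' y t (z - y)‖ ≤ ε * ‖z - y‖ := by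
  have h1 : ∀ᶠ z in nhds y, ∀ t ∈ Set.Icc (0 : ℝ) 1, ‖F' z t - F' y t‖ < ε := by
    refine isCompact_Icc.eventually_forall_of_forall_eventually fun t _ => ?_
    have hcc : Continuous fun q : M × ℝ => ‖F' q.1 q.2 - F' y q.2‖ :=
      (hc.sub (hc.comp (continuous_const.prodMk continuous_snd))).norm
    refine hcc.continuousAt.eventually_lt continuousAt_const ?_
    simpa using hε
  obtain ⟨δ, hδ, hball⟩ := Metric.eventually_nhds_iff_ball.1 h1
  filter_upwards [Metric.ball_mem_nhds y hδ] with z hz t ht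
  exact Convex.norm_image_sub_le_of_norm_hasFDerivWithin_le' (s := Metric.ball y δ)
    (fun x _ => (hF x t).hasFDerivWithinAt) (fun x hx => (hball x hx t ht).le)
    (convex_ball _ _) (Metric.mem_ball_self hδ) hz

theorem hasFDerivAt_of_rays {M V : Type*} [NormedAddCommGroup M] [NormedSpace ℝ M]
    [NormedAddCommGroup V] [NormedSpace ℝ V] [CompleteSpace V]
    (Γ : M → M →L[ℝ] V →L[ℝ] V) (hΓ : ∀ x, AnalyticAt ℝ Γ x) (x₀ : M) (e : V)
    (y : M) (σ : M → ℝ → V) (hσ0 : ∀ᶠ z in nhds y, σ z 0 = e)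
    (hσ' : ∀ᶠ z in nhds y, ∀ t ∈ Set.Icc (0 : ℝ) 1,
      HasDerivAt (σ z) (-(Γ (x₀ + t • z) z (σ z t))) t)
    (hR : ∀ w : M, ∀ t ∈ Set.Icc (0 : ℝ) 1, curvEnd Γ y w (x₀ + t • y) (σ y t) = 0) :
    HasFDerivAt (fun z => σ z 1) (-(Γ (x₀ + y)).flip (σ y 1)) y := by
  -- the coefficient of the radial equation and its derivative in `z`
  let F : M → ℝ → V →L[ℝ] V := fun z t => Γ (x₀ + t • z) z
  let F' : M → ℝ → M →L[ℝ] (V →L[ℝ] V) := fun z t =>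
    Γ (x₀ + t • z) + t • (fderiv ℝ Γ (x₀ + t • z)).flip z
  have hΓc : Continuous Γ := continuous_iff_continuousAt.2 fun x => (hΓ x).continuousAt
  have hΓc' : Continuous (fderiv ℝ Γ) :=
    continuous_iff_continuousAt.2 fun x => (hΓ x).fderiv.continuousAt
  have hray : Continuous fun q : M × ℝ => x₀ + q.2 • q.1 := by fun_prop
  have hFc : Continuous fun q : M × ℝ => F q.1 q.2 := (hΓc.comp hray).clm_apply continuous_fst
  have hF'c : Continuous fun q : M × ℝ => F' q.1 q.2 := by
    refine (hΓc.comp hray).add (continuous_snd.smul ?_)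
    exact ((ContinuousLinearMap.flipₗᵢ ℝ M M (V →L[ℝ] V)).continuous.comp
      (hΓc'.comp hray)).clm_apply continuous_fst
  have hF : ∀ z t, HasFDerivAt (fun z => F z t) (F' z t) z := by
    intro z t
    have h1 : HasFDerivAt (fun z : M => x₀ + t • z) (t • ContinuousLinearMap.id ℝ M) z :=
      ((hasFDerivAt_id z).const_smul t).const_add x₀
    have h2 : HasFDerivAt (fun z : M => Γ (x₀ + t • z))
        ((fderiv ℝ Γ (x₀ + t • z)).comp (t • ContinuousLinearMap.id ℝ M)) z :=
      HasFDerivAt.comp (g := Γ) (f := fun z : M => x₀ + t • z) z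
        (hΓ (x₀ + t • z)).differentiableAt.hasFDerivAt h1
    have h3 := h2.clm_apply (hasFDerivAt_id z)
    refine h3.congr_fderiv ?_
    ext v u
    simp [F']
  have hσy := hσ'.self_of_nhds
  have hσc : ContinuousOn (σ y) (Set.Icc 0 1) := fun t ht =>
    (hσy t ht).continuousAt.continuousWithinAt
  obtain ⟨B, hB⟩ := isCompact_Icc.exists_bound_of_continuousOn hσc
  have hΓr : Continuous fun t : ℝ => Γ (x₀ + t • y) := hΓc.comp (by fun_prop)
  obtain ⟨C, hC⟩ := (isCompact_Icc (a := (0 : ℝ)) (b := 1)).exists_bound_of_continuousOn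
    (f := fun t : ℝ => Γ (x₀ + t • y)) hΓr.continuousOn
  have hFr : Continuous fun t : ℝ => F y t := hΓr.clm_apply continuous_const
  obtain ⟨K, hK⟩ := (isCompact_Icc (a := (0 : ℝ)) (b := 1)).exists_bound_of_continuousOn
    (f := fun t : ℝ => F y t) hFr.continuousOn
  have h01 : (0 : ℝ) ∈ Set.Icc (0 : ℝ) 1 := ⟨le_rfl, zero_le_one⟩
  have hB0 : 0 ≤ B := (norm_nonneg _).trans (hB 0 h01)
  have hC0 : 0 ≤ C := (norm_nonneg _).trans (hC 0 h01)
  have hK0 : 0 ≤ K := (norm_nonneg _).trans (hK 0 h01)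
  -- the Lipschitz constant
  set L : ℝ := K + 1 with hL
  have hLpos : 0 < L := by positivity
  set c : ℝ := (B + C * B) / L * (Real.exp L - 1) + 1 with hc
  have hexp : 0 ≤ Real.exp L - 1 := by
    have := Real.one_le_exp hLpos.le
    linarith
  have hcpos : 0 < c := by positivity
  rw [hasFDerivAt_iff_isLittleO, Asymptotics.isLittleO_iff]
  intro ε hε
  set η : ℝ := min 1 (ε / c) with hη
  have hηpos : 0 < η := lt_min one_pos (by positivity)
  have hclose : ∀ᶠ z in nhds y, ∀ t ∈ Set.Icc (0 : ℝ) 1, ‖F z t - F y t‖ < η := by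
    refine isCompact_Icc.eventually_forall_of_forall_eventually fun t _ => ?_
    have hcc : Continuous fun q : M × ℝ => ‖F q.1 q.2 - F y q.2‖ :=
      (hFc.sub (hFc.comp (continuous_const.prodMk continuous_snd))).norm
    refine hcc.continuousAt.eventually_lt continuousAt_const ?_
    simpa using hηpos
  filter_upwards [hclose, uniform_taylor F F' y hF hF'c η hηpos, hσ', hσ0] with z hz1 hz2 hz3 hz4
  set h := z - y with hh
  -- the approximate solution
  let τ : ℝ → V := fun t => σ y t - t • Γ (x₀ + t • y) h (σ y t)
  have hτ' : ∀ t ∈ Set.Icc (0 : ℝ) 1, HasDerivAt τ (-(F y t (σ y t)) -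
      (t • (fderiv ℝ Γ (x₀ + t • y) y h (σ y t) - Γ (x₀ + t • y) h (F y t (σ y t))) +
        Γ (x₀ + t • y) h (σ y t))) t := by
    intro t ht
    have h1 : HasDerivAt (fun t : ℝ => Γ (x₀ + t • y)) (fderiv ℝ Γ (x₀ + t • y) y) t :=
      HasFDerivAt.comp_hasDerivAt (l := Γ) (f := fun t : ℝ => x₀ + t • y) t
        (hΓ (x₀ + t • y)).differentiableAt.hasFDerivAt (hasDerivAt_ray x₀ y t)
    have h2 := h1.clm_apply (hasDerivAt_const t h)
    have h3 := h2.clm_apply (hσy t ht)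
    have h4 := (hσy t ht).sub ((hasDerivAt_id t).smul h3)
    refine h4.congr_deriv ?_
    simp [F, sub_eq_add_neg]
  have hdist := dist_le_of_approx_trajectories_ODE_of_mem (a := 0) (b := 1) (E := V)
    (v := fun t u => -(F z t u)) (s := fun _ => Set.univ) (K := ⟨L, hLpos.le⟩)
    (f := σ z) (g := τ) (f' := fun t => -(F z t (σ z t)))
    (g' := fun t => -(F y t (σ y t)) -
      (t • (fderiv ℝ Γ (x₀ + t • y) y h (σ y t) - Γ (x₀ + t • y) h (F y t (σ y t))) +
        Γ (x₀ + t • y) h (σ y t))) (εf := 0) (εg := η * (B + C * B) * ‖h‖) (δ := 0)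
    (by
      intro t ht
      have ht' := Set.Ico_subset_Icc_self ht
      refine LipschitzOnWith.of_dist_le_mul fun u _ u' _ => ?_
      rw [dist_neg_neg, dist_eq_norm, ← map_sub, dist_eq_norm]
      refine (F z t).le_of_opNorm_le ?_ _
      have h1 := (hz1 t ht').le.trans (min_le_left _ _)
      have h2 := hK t ht'
      have h3 : F z t = (F z t - F y t) + F y t := by abel
      rw [h3]
      refine (norm_add_le _ _).trans ?_
      change _ ≤ K + 1
      linarith)
    (fun t ht => (hz3 t ht).continuousAt.continuousWithinAt)
    (fun t ht => (hz3 t (Set.Ico_subset_Icc_self ht)).hasDerivWithinAt)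
    (fun t ht => by simp) (fun _ _ => trivial)
    (fun t ht => (hτ' t ht).continuousAt.continuousWithinAt)
    (fun t ht => (hτ' t (Set.Ico_subset_Icc_self ht)).hasDerivWithinAt)
    (by
      intro t ht
      have ht' := Set.Ico_subset_Icc_self ht
      have hRt := hR h t ht'
      simp only [curvEnd] at hRt
      have hkey : -(F y t (σ y t)) -
          (t • (fderiv ℝ Γ (x₀ + t • y) y h (σ y t) - Γ (x₀ + t • y) h (F y t (σ y t))) +
            Γ (x₀ + t • y) h (σ y t)) - -(F z t (τ t)) =
          (F z t - F y t - F' y t h) (σ y t) -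
            t • (F z t - F y t) (Γ (x₀ + t • y) h (σ y t)) := by
        have hR2 : fderiv ℝ Γ (x₀ + t • y) y h (σ y t) - Γ (x₀ + t • y) h (F y t (σ y t)) =
            fderiv ℝ Γ (x₀ + t • y) h y (σ y t) - F y t (Γ (x₀ + t • y) h (σ y t)) := by
          rw [← sub_eq_zero, ← hRt]
          simp [F]
          abel
        rw [hR2]
        simp [F', τ, smul_sub]
        abel
      rw [dist_eq_norm, hkey]
      refine (norm_sub_le _ _).trans ?_
      have e1 : ‖(F z t - F y t - F' y t h) (σ y t)‖ ≤ (η * ‖h‖) * B :=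
        ((F z t - F y t - F' y t h).le_opNorm _).trans
          (mul_le_mul (hz2 t ht') (hB t ht') (norm_nonneg _) (by positivity))
      have e2 : ‖Γ (x₀ + t • y) h (σ y t)‖ ≤ C * ‖h‖ * B :=
        ((Γ (x₀ + t • y) h).le_opNorm _).trans
          (mul_le_mul ((Γ (x₀ + t • y)).le_of_opNorm_le (hC t ht') h) (hB t ht')
            (norm_nonneg _) (by positivity))
      have e3 : ‖(F z t - F y t) (Γ (x₀ + t • y) h (σ y t))‖ ≤ η * (C * ‖h‖ * B) :=
        ((F z t - F y t).le_opNorm _).trans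
          (mul_le_mul (hz1 t ht').le e2 (norm_nonneg _) hηpos.le)
      have e4 : ‖t • (F z t - F y t) (Γ (x₀ + t • y) h (σ y t))‖ ≤ 1 * (η * (C * ‖h‖ * B)) := by
        rw [norm_smul, Real.norm_of_nonneg ht'.1]
        exact mul_le_mul ht'.2 e3 (norm_nonneg _) zero_le_one
      calc _ ≤ (η * ‖h‖) * B + 1 * (η * (C * ‖h‖ * B)) := add_le_add e1 e4
        _ = _ := by ring)
    (fun _ _ => trivial)
    (by simp [τ, hz4, hσ0.self_of_nhds]) 1 ⟨zero_le_one, le_rfl⟩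
  have hval : σ z 1 - σ y 1 - (-(Γ (x₀ + y)).flip (σ y 1)) h = σ z 1 - τ 1 := by
    simp [τ]
    abel
  rw [hval, ← dist_eq_norm]
  refine hdist.trans ?_
  change gronwallBound 0 L _ _ ≤ _
  rw [gronwallBound_of_K_ne_0 hLpos.ne']
  simp only [zero_mul, zero_add, sub_zero, mul_one]
  have hηc : η * c ≤ ε := by
    have := min_le_right 1 (ε / c)
    rwa [← hη, le_div_iff₀ hcpos] at this
  calc η * (B + C * B) * ‖h‖ / L * (Real.exp L - 1)
      = η * ((B + C * B) / L * (Real.exp L - 1)) * ‖h‖ := by ring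
    _ ≤ η * c * ‖h‖ := by gcongr; linarith
    _ ≤ ε * ‖h‖ := by gcongr

theorem exists_local_parallel_section_of_higher_order_flatness
    {M V : Type*} [NormedAddCommGroup M] [NormedSpace ℝ M] [FiniteDimensional ℝ M]
    [NormedAddCommGroup V] [NormedSpace ℝ V] [FiniteDimensional ℝ V]
    (Γ : M → M →L[ℝ] V →L[ℝ] V) (hΓ : AnalyticOnNhd ℝ Γ Set.univ)
    (x₀ : M) (e : V)
    -- all the iterated covariant derivatives of the curvature kill `e` at `x₀`:
    (hflat : ∀ (l : List M) (v w : M),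
      (l.foldr (covDerEnd Γ) (curvEnd Γ v w)) x₀ e = 0) :
    ∃ (U : Set M) (s : M → V), IsOpen U ∧ x₀ ∈ U ∧
      ContDiffOn ℝ (⊤ : ℕ∞) s U ∧ s x₀ = e ∧
      -- `s` is a `∇`-parallel section: `∇_v s = 0` on `U`.
      ∀ x ∈ U, ∀ v : M, fderivWithin ℝ s U x v + Γ x v (s x) = 0 := by
  have hΓ' : ∀ x, AnalyticAt ℝ Γ x := fun x => hΓ x trivial
  have : CompleteSpace V := FiniteDimensional.complete ℝ V
  obtain ⟨p, r, hp⟩ := hΓ' x₀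
  obtain ⟨ρ, hρ0, hρr⟩ := ENNReal.lt_iff_exists_nnreal_btwn.1 hp.r_pos
  have hρ : (0 : ℝ) < ρ := by exact_mod_cast hρ0
  obtain ⟨C, hC, hpC⟩ := p.norm_mul_pow_le_of_lt_radius (hρr.trans_le hp.r_le)
  set δ : ℝ := min (1 / (4 * C)) (ρ / 4) with hδ
  have hδ0 : 0 < δ := lt_min (by positivity) (by positivity)
  have hsol : ∀ y ∈ Metric.ball (0 : M) δ, ∃ σ : ℝ → V, σ 0 = e ∧
      AnalyticOnNhd ℝ σ (Metric.ball 0 2) ∧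
      ∀ t ∈ Metric.ball (0 : ℝ) 2, HasDerivAt σ (-(Γ (x₀ + t • y) y (σ t))) t := by
    intro y hy
    rw [mem_ball_zero_iff] at hy
    have hy1 : C * ‖y‖ ≤ 1 / 4 := by
      have := hy.le.trans (min_le_left _ _)
      rw [le_div_iff₀ (by positivity)] at this
      linarith
    have hy2 : ‖y‖ ≤ ρ / 4 := hy.le.trans (min_le_right _ _)
    obtain ⟨P, hP0, hPa, hP'⟩ := exists_analytic_ode_solution
      (fun t : ℝ => Γ (x₀ + t • y) y) (fun k => p k (fun _ => y) y) (by
        intro k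
        have h1 : ‖p k (fun _ => y)‖ ≤ ‖p k‖ * ‖y‖ ^ k := by
          simpa using (p k).le_opNorm (fun _ => y)
        calc ‖p k (fun _ => y) y‖ ≤ ‖p k (fun _ => y)‖ * ‖y‖ := ContinuousLinearMap.le_opNorm _ _
          _ ≤ ‖p k‖ * ‖y‖ ^ k * ‖y‖ := by gcongr
          _ ≤ ‖p k‖ * (ρ / 4) ^ k * ‖y‖ := by gcongr
          _ = (‖p k‖ * ρ ^ k) * ‖y‖ * (1 / 4) ^ k := by rw [div_pow, div_pow]; ring
          _ ≤ C * ‖y‖ * (1 / 4) ^ k := by gcongr; exact hpC k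
          _ ≤ 1 / 4 * (1 / 4) ^ k := by gcongr
          _ = _ := by rw [pow_succ]; ring) (by
        intro t ht
        rw [mem_ball_zero_iff] at ht
        have hmem : t • y ∈ Metric.eball (0 : M) r := by
          rw [Metric.mem_eball, edist_zero_right, ← ofReal_norm]
          refine lt_of_le_of_lt ?_ hρr
          rw [ENNReal.ofReal_le_coe]
          rw [norm_smul]
          nlinarith [norm_nonneg y, norm_nonneg t]
        have h1 := hp.hasSum hmem
        have h2 := (ContinuousLinearMap.apply ℝ (V →L[ℝ] V) y).hasSum h1
        have h3 : (fun k => t ^ k • p k (fun _ => y) y) =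
            fun k => ContinuousLinearMap.apply ℝ (V →L[ℝ] V) y (p k fun _ => t • y) := by
          funext k
          have h4 := (p k).map_smul_univ (fun _ => t) (fun _ => y)
          rw [h4]
          simp
        rw [← h3] at h2
        exact h2)
    refine ⟨fun t => P t e, by simp [hP0], fun t ht =>
      analyticAt_clm_apply' (hPa t ht) analyticAt_const, fun t ht => ?_⟩
    have := (hP' t ht).clm_apply (hasDerivAt_const t e)
    simpa using this
  choose! σ hσ0 hσa hσ' using hsol
  have hIcc : ∀ t ∈ Set.Icc (0 : ℝ) 1, t ∈ Metric.ball (0 : ℝ) 2 := by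
    intro t ht
    rw [mem_ball_zero_iff, Real.norm_of_nonneg ht.1]
    linarith [ht.2]
  have hder : ∀ x ∈ Metric.ball x₀ δ, HasFDerivAt (fun x => σ (x - x₀) 1)
      (-(Γ x).flip (σ (x - x₀) 1)) x := by
    intro x hx
    have hy : x - x₀ ∈ Metric.ball (0 : M) δ := by
      rwa [mem_ball_zero_iff, ← dist_eq_norm]
    have hnhds := Metric.isOpen_ball.mem_nhds hy
    have h1 := hasFDerivAt_of_rays Γ hΓ' x₀ e (x - x₀) σ
      (by filter_upwards [hnhds] with z hz using hσ0 z hz)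
      (by filter_upwards [hnhds] with z hz t ht using hσ' z hz t (hIcc t ht))
      (fun w t ht => curvature_kills_along_ray Γ hΓ' x₀ e hflat _ _ (hσa _ hy) (hσ0 _ hy)
        (hσ' _ hy) w t (hIcc t ht))
    rw [add_sub_cancel] at h1
    exact h1.comp x ((hasFDerivAt_id x).sub_const x₀)
  refine ⟨Metric.ball x₀ δ, fun x => σ (x - x₀) 1, Metric.isOpen_ball,
    Metric.mem_ball_self hδ0, ?_, ?_, ?_⟩
  · rw [contDiffOn_infty]
    intro n
    induction n with
    | zero =>
      rw [Nat.cast_zero, contDiffOn_zero]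
      exact fun x hx => (hder x hx).continuousAt.continuousWithinAt
    | succ n ih =>
      rw [Nat.cast_succ, contDiffOn_succ_iff_hasFDerivWithinAt_of_uniqueDiffOn
        Metric.isOpen_ball.uniqueDiffOn]
      refine ⟨by simp, fun x => -(Γ x).flip (σ (x - x₀) 1), ?_,
        fun x hx => (hder x hx).hasFDerivWithinAt⟩
      rw [contDiffOn_clm_apply]
      intro v
      have hΓs : ContDiffOn ℝ n Γ (Metric.ball x₀ δ) := fun x _ =>
        (hΓ' x).contDiffAt.contDiffWithinAt
      exact ((hΓs.clm_apply contDiffOn_const).clm_apply ih).neg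
  · have h0 : (0 : M) ∈ Metric.ball (0 : M) δ := Metric.mem_ball_self hδ0
    have hd : ∀ t ∈ Set.Ico (0 : ℝ) 1, HasDerivWithinAt (σ 0) 0 (Set.Ici t) t := fun t ht => by
      have := hσ' 0 h0 t (hIcc t (Set.Ico_subset_Icc_self ht))
      simpa using this.hasDerivWithinAt
    have hcst := constant_of_has_deriv_right_zero (a := (0 : ℝ)) (b := 1) (f := σ 0)
      (fun t ht => (hσ' 0 h0 t (hIcc t ht)).continuousAt.continuousWithinAt) hd 1
      ⟨zero_le_one, le_rfl⟩
    simp only [sub_self]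
    rw [hcst, hσ0 0 h0]
  · intro x hx v
    rw [fderivWithin_of_isOpen Metric.isOpen_ball hx, (hder x hx).fderiv]
    simp
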